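/- For n = 4, the invariant field k(X)_0^G is generated over k by the first four observables: k(X)_0^G = k(q_1, q_2, q_3, q_4). (This improves the general bound n(n-1)/2 = 6 of the main theorem in this case.) -/

import Mathlib

noncomputable section

open scoped Classical

abbrev RF (k : Type) [Field k] (n : ℕ) := FractionRing (MvPolynomial (Fin n) k)

def xv (k : Type) [Field k] (n : ℕ) (i : Fin n) : RF k n :=
  algebraMap (MvPolynomial (Fin n) k) (RF k n) (MvPolynomial.X i)

/-- The set of ratios `x_i / x_j`, `i ≠ j`, generating `k(X)₀`. -/
def ratioSet (k : Type) [Field k] (n : ℕ) : Set (RF k n) :=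
  {r | ∃ i j : Fin n, i ≠ j ∧ r = xv k n i / xv k n j}

/-- The observable `q_r = tr(X^r) · tr(X^{-r})`. -/
def qObs (k : Type) [Field k] (n : ℕ) (r : ℤ) : RF k n :=
  (∑ i, xv k n i ^ r) * (∑ i, xv k n i ^ (-r))

/-- The subgroup of automorphisms generated by the image of `G = S_n × T`. -/
def Gsub (k : Type) [Field k] (n : ℕ) : Subgroup (RF k n ≃ₐ[k] RF k n) :=
  Subgroup.closure {φ | ∃ σ : Equiv.Perm (Fin n),
    (∀ i, φ (xv k n i) = xv k n (σ i)) ∨ (∀ i, φ (xv k n i) = (xv k n (σ i))⁻¹)}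

/-- The invariant field `k(X)₀^G`. -/
def InvF (k : Type) [Field k] (n : ℕ) : IntermediateField k (RF k n) :=
  IntermediateField.adjoin k (ratioSet k n) ⊓ IntermediateField.fixedField (Gsub k n)

section Automorphisms

variable {k : Type} [Field k] {n : ℕ}

lemma xv_ne_zero (i : Fin n) : xv k n i ≠ 0 := by
  simp [xv]

lemma algHom_ext_xv {L : Type*} [Field L] [Algebra k L] {φ ψ : RF k n →ₐ[k] L}
    (h : ∀ i, φ (xv k n i) = ψ (xv k n i)) : φ = ψ := by
  apply IsLocalization.algHom_ext (nonZeroDivisors (MvPolynomial (Fin n) k))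
  apply MvPolynomial.algHom_ext
  intro i
  exact h i

lemma adjoin_range_xv : IntermediateField.adjoin k (Set.range (xv k n)) = ⊤ := by
  rw [eq_top_iff]
  intro z _
  have hP (P : MvPolynomial (Fin n) k) :
      algebraMap _ (RF k n) P ∈ IntermediateField.adjoin k (Set.range (xv k n)) := by
    induction P using MvPolynomial.induction_on with
    | C a =>
      have : algebraMap _ (RF k n) (MvPolynomial.C a : MvPolynomial (Fin n) k)
          = algebraMap k (RF k n) a := by
        rw [← MvPolynomial.algebraMap_eq, ← IsScalarTower.algebraMap_apply]
      rw [this]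
      exact IntermediateField.algebraMap_mem _ a
    | add p q hp hq => rw [map_add]; exact add_mem hp hq
    | mul_X p i hp =>
      rw [map_mul]
      exact mul_mem hp (IntermediateField.subset_adjoin _ _ ⟨i, rfl⟩)
  obtain ⟨P, Q, _, rfl⟩ := IsFractionRing.div_surjective (A := MvPolynomial (Fin n) k) z
  exact div_mem (hP P) (hP Q)

lemma trdeg_RF : Algebra.trdeg k (RF k n) = n := by
  have : Algebra.IsAlgebraic (MvPolynomial (Fin n) k) (RF k n) :=
    IsLocalization.isAlgebraic _ (nonZeroDivisors (MvPolynomial (Fin n) k))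
  have h : IsTranscendenceBasis k (xv k n) :=
    (IsTranscendenceBasis.mvPolynomial (Fin n) k).algebraMap_comp
  simpa using h.lift_cardinalMk_eq_trdeg.symm

lemma exists_algHom_xv {y : Fin n → RF k n}
    (hy : ∀ i, xv k n i ∈ IntermediateField.adjoin k (Set.range y)) :
    ∃ φ : RF k n →ₐ[k] RF k n, ∀ i, φ (xv k n i) = y i := by
  have htop : IntermediateField.adjoin k (Set.range y) = ⊤ := by
    rw [eq_top_iff, ← adjoin_range_xv, IntermediateField.adjoin_le_iff]
    rintro _ ⟨i, rfl⟩
    exact hy i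
  have halg : Algebra.IsAlgebraic (Algebra.adjoin k (Set.range y)) (RF k n) := by
    constructor
    intro z
    have hz : z ∈ IntermediateField.adjoin k (Set.range y) := htop ▸ IntermediateField.mem_top
    rw [IntermediateField.mem_adjoin_iff_div] at hz
    obtain ⟨r, hr, s, hs, rfl⟩ := hz
    rw [div_eq_mul_inv]
    exact (isAlgebraic_algebraMap (⟨r, hr⟩ : Algebra.adjoin k (Set.range y))).mul
      (isAlgebraic_algebraMap (⟨s, hs⟩ : Algebra.adjoin k (Set.range y))).inv
  have hb := Algebra.IsAlgebraic.isTranscendenceBasis_of_lift_le_trdeg_of_finite (R := k) y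
    (by simp [trdeg_RF])
  have hinj : Function.Injective (MvPolynomial.aeval (R := k) y) := hb.1
  refine ⟨IsFractionRing.liftAlgHom hinj, fun i => ?_⟩
  rw [IsFractionRing.liftAlgHom_apply]
  simp [xv, IsFractionRing.lift_algebraMap]

lemma exists_algEquiv_xv {y z : Fin n → RF k n}
    (hy : ∀ φ : RF k n →ₐ[k] RF k n, (∀ i, φ (xv k n i) = y i) → ∀ i, φ (z i) = xv k n i)
    (hz : ∀ φ : RF k n →ₐ[k] RF k n, (∀ i, φ (xv k n i) = z i) → ∀ i, φ (y i) = xv k n i)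
    (hy' : ∀ i, xv k n i ∈ IntermediateField.adjoin k (Set.range y))
    (hz' : ∀ i, xv k n i ∈ IntermediateField.adjoin k (Set.range z)) :
    ∃ φ : RF k n ≃ₐ[k] RF k n, ∀ i, φ (xv k n i) = y i := by
  obtain ⟨φ, hφ⟩ := exists_algHom_xv hy'
  obtain ⟨ψ, hψ⟩ := exists_algHom_xv hz'
  refine ⟨AlgEquiv.ofAlgHom φ ψ (algHom_ext_xv fun i => ?_) (algHom_ext_xv fun i => ?_), hφ⟩
  · simp [hψ, hy φ hφ]
  · simp [hφ, hz ψ hψ]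

lemma exists_perm_algEquiv (σ : Equiv.Perm (Fin n)) :
    ∃ φ : RF k n ≃ₐ[k] RF k n, ∀ i, φ (xv k n i) = xv k n (σ i) := by
  refine exists_algEquiv_xv (z := fun i => xv k n (σ.symm i)) ?_ ?_ ?_ ?_
  · intro φ h i; simp [h]
  · intro φ h i; simp [h]
  · intro i; exact IntermediateField.subset_adjoin _ _ ⟨σ.symm i, by simp⟩
  · intro i; exact IntermediateField.subset_adjoin _ _ ⟨σ i, by simp⟩

lemma exists_inv_algEquiv :
    ∃ φ : RF k n ≃ₐ[k] RF k n, ∀ i, φ (xv k n i) = (xv k n i)⁻¹ := by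
  have h (i : Fin n) : xv k n i ∈
      IntermediateField.adjoin k (Set.range fun i => (xv k n i)⁻¹) := by
    rw [← inv_inv (xv k n i)]
    exact inv_mem (IntermediateField.subset_adjoin _ _ ⟨i, rfl⟩)
  refine exists_algEquiv_xv (z := fun i => (xv k n i)⁻¹) ?_ ?_ h h
  · intro φ h i; simp [h]
  · intro φ h i; simp [h]

lemma exists_scale_algHom {c : k} (hc : c ≠ 0) :
    ∃ φ : RF k n →ₐ[k] RF k n, ∀ i, φ (xv k n i) = algebraMap k _ c * xv k n i := by
  refine exists_algHom_xv fun i => ?_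
  have h0 : algebraMap k (RF k n) c ≠ 0 := by simpa using hc
  have h : xv k n i = algebraMap k (RF k n) c⁻¹ * (algebraMap k _ c * xv k n i) := by
    rw [map_inv₀]; field_simp
  rw [h]
  exact mul_mem (IntermediateField.algebraMap_mem _ _)
    (IntermediateField.subset_adjoin _ _ ⟨i, rfl⟩)

end Automorphisms

section Symmetric

variable {k : Type} [Field k] {n : ℕ}

lemma perm_algEquiv_algebraMap {σ : Equiv.Perm (Fin n)} {φ : RF k n ≃ₐ[k] RF k n}
    (h : ∀ i, φ (xv k n i) = xv k n (σ i)) (P : MvPolynomial (Fin n) k) :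
    φ (algebraMap _ (RF k n) P) = algebraMap _ (RF k n) (MvPolynomial.rename σ P) := by
  have : ((φ : RF k n →ₐ[k] RF k n).comp
      (Algebra.algHom k (MvPolynomial (Fin n) k) (RF k n))) =
      (Algebra.algHom k (MvPolynomial (Fin n) k) (RF k n)).comp (MvPolynomial.rename σ) := by
    apply MvPolynomial.algHom_ext
    intro i
    rw [AlgHom.comp_apply, AlgHom.comp_apply, MvPolynomial.rename_X]
    exact h i
  exact DFunLike.congr_fun this P

lemma exists_isSymmetric_div {f : RF k n}
    (hf : ∀ (σ : Equiv.Perm (Fin n)) (φ : RF k n ≃ₐ[k] RF k n),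
      (∀ i, φ (xv k n i) = xv k n (σ i)) → φ f = f) :
    ∃ P Q : MvPolynomial (Fin n) k, P.IsSymmetric ∧ Q.IsSymmetric ∧
      f = algebraMap _ _ P / algebraMap _ _ Q := by
  obtain ⟨P, Q, hQ, rfl⟩ := IsFractionRing.div_surjective (A := MvPolynomial (Fin n) k) f
  have hQ0 : Q ≠ 0 := nonZeroDivisors.ne_zero hQ
  set N : MvPolynomial (Fin n) k := ∏ σ : Equiv.Perm (Fin n), MvPolynomial.rename σ Q with hN
  have hN0 : N ≠ 0 := by
    rw [hN, Finset.prod_ne_zero_iff]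
    intro σ _ h
    exact hQ0 (MvPolynomial.rename_injective σ σ.injective (by rw [h, map_zero]))
  have hNs : N.IsSymmetric := by
    intro τ
    rw [hN, map_prod]
    refine Fintype.prod_equiv (Equiv.mulLeft τ) _ _ fun σ => ?_
    rw [MvPolynomial.rename_rename]
    rfl
  obtain ⟨Q', hQ'⟩ : Q ∣ N := by
    have := Finset.dvd_prod_of_mem (fun σ : Equiv.Perm (Fin n) => MvPolynomial.rename σ Q)
      (Finset.mem_univ 1)
    simpa using this
  have hinj := IsFractionRing.injective (MvPolynomial (Fin n) k) (RF k n)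
  have hQm : algebraMap _ (RF k n) Q ≠ 0 := by simpa using hQ0
  have hNm : algebraMap _ (RF k n) N ≠ 0 := by simpa using hN0
  have heq : algebraMap _ (RF k n) P / algebraMap _ _ Q =
      algebraMap _ _ (P * Q') / algebraMap _ _ N := by
    rw [div_eq_div_iff hQm hNm, ← map_mul, ← map_mul, hQ']
    congr 1; ring
  refine ⟨P * Q', N, fun σ => ?_, hNs, heq⟩
  obtain ⟨φ, hφ⟩ := exists_perm_algEquiv (k := k) σ
  have h := hf σ φ hφ
  rw [heq, map_div₀, perm_algEquiv_algebraMap hφ, perm_algEquiv_algebraMap hφ, hNs σ,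
    div_left_inj' hNm] at h
  exact hinj h

lemma algebraMap_mem_of_isSymmetric {P : MvPolynomial (Fin n) k} (hP : P.IsSymmetric)
    {K : IntermediateField k (RF k n)}
    (hK : ∀ i : Fin n, algebraMap _ _ (MvPolynomial.esymm (Fin n) k (i + 1)) ∈ K) :
    algebraMap _ (RF k n) P ∈ K := by
  obtain ⟨p, hp⟩ := MvPolynomial.esymmAlgHom_surjective (σ := Fin n) (R := k) (n := n)
    (Fintype.card_fin n).le ⟨P, hP⟩
  have hp' := MvPolynomial.esymmAlgHom_apply (σ := Fin n) (R := k) (n := n) p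
  rw [hp] at hp'
  change P = _ at hp'
  rw [hp']
  clear hp hp' hP
  induction p using MvPolynomial.induction_on with
  | C a =>
    rw [MvPolynomial.aeval_C, ← IsScalarTower.algebraMap_apply]
    exact K.algebraMap_mem a
  | add p q hp hq =>
    rw [map_add, map_add]
    exact add_mem hp hq
  | mul_X p i hp =>
    rw [map_mul, map_mul, MvPolynomial.aeval_X]
    exact mul_mem hp (hK i)

end Symmetric

section Descent

lemma transcendental_of_injective_algHom {L E : Type*} [Field L] [Field E] [Algebra L E] {t : E}
    (g : ℕ → E →ₐ[L] E) (hg : Function.Injective fun m => g m t) : Transcendental L t := by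
  rintro ⟨p, hp0, hp⟩
  refine Set.infinite_of_injective_forall_mem hg (s := p.rootSet E) (fun m => ?_)
    (Polynomial.rootSet_finite p E)
  rw [Polynomial.mem_rootSet, Polynomial.aeval_algHom_apply, hp, map_zero]
  exact ⟨hp0, rfl⟩

variable {k E : Type*} [Field k] [Field E] [Algebra k E]

lemma IntermediateField.mem_of_mem_adjoin_of_transcendental {M L : IntermediateField k E}
    (hML : M ≤ L) {t f : E} (ht : Transcendental L t) (hfL : f ∈ L)
    (hf : f ∈ IntermediateField.adjoin M {t}) : f ∈ M := by
  rw [IntermediateField.mem_adjoin_simple_iff] at hf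
  obtain ⟨p, q, hpq⟩ := hf
  have hinj := transcendental_iff_injective.mp ht
  let ι := (IntermediateField.inclusion hML : M →ₐ[k] L)
  have hmap (r : Polynomial M) : Polynomial.aeval t (r.map ι.toRingHom) = Polynomial.aeval t r := by
    rw [Polynomial.aeval_def, Polynomial.aeval_def, Polynomial.eval₂_map]
    rfl
  by_cases hq : q = 0
  · rw [hpq, hq]; simp
  have hq0 : Polynomial.aeval t q ≠ 0 := by
    rw [← hmap]
    intro h
    have := hinj (h.trans (map_zero _).symm)
    exact hq ((Polynomial.map_eq_zero _).mp this)
  have h1 : Polynomial.C (⟨f, hfL⟩ : L) * q.map ι.toRingHom = p.map ι.toRingHom := by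
    apply hinj
    rw [map_mul, hmap, hmap, Polynomial.aeval_C]
    exact (eq_div_iff hq0).mp hpq
  have h2 := congrArg (fun r => (r.coeff q.natDegree : E)) h1
  simp only [Polynomial.coeff_C_mul, Polynomial.coeff_map] at h2
  have h3 : f * (q.leadingCoeff : E) = (p.coeff q.natDegree : E) := h2
  have h4 : (q.leadingCoeff : E) ≠ 0 := by simpa using hq
  rw [eq_div_of_mul_eq h4 h3]
  exact div_mem (SetLike.coe_mem _) (SetLike.coe_mem _)

/-- An element of `K(c)`, with `c` quadratic over `K`, which is fixed by a `K`-automorphism that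
moves `c`, lies in `K`. -/
lemma IntermediateField.mem_of_mem_adjoin_quadratic {K : IntermediateField k E} {c f u v : E}
    (hu : u ∈ K) (hv : v ∈ K) (hc : c ^ 2 = u * c + v) (hf : f ∈ IntermediateField.adjoin K {c})
    {φ : E →ₐ[k] E} (hφ : ∀ x ∈ K, φ x = x) (hφc : φ c ≠ c) (hφf : φ f = f) : f ∈ K := by
  have hint : IsAlgebraic K c := by
    refine ⟨Polynomial.X ^ 2 - Polynomial.C (⟨u, hu⟩ : K) * Polynomial.X
      - Polynomial.C (⟨v, hv⟩ : K), ?_, ?_⟩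
    · intro h
      have := congrArg (fun p => Polynomial.coeff p 2) h
      simp at this
    · simp only [map_sub, map_mul, map_pow, Polynomial.aeval_X, Polynomial.aeval_C]
      change c ^ 2 - u * c - v = 0
      rw [hc]; ring
  rw [← IntermediateField.mem_toSubalgebra,
    IntermediateField.adjoin_simple_toSubalgebra_of_isAlgebraic hint] at hf
  have key : ∃ a ∈ K, ∃ b ∈ K, f = a + b * c := by
    clear hφf
    induction hf using Algebra.adjoin_induction with
    | mem x hx => exact ⟨0, zero_mem _, 1, one_mem _, by simpa using hx⟩
    | algebraMap r => exact ⟨r, r.2, 0, zero_mem _, by simp⟩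
    | add x y _ _ hx hy =>
      obtain ⟨a, ha, b, hb, rfl⟩ := hx
      obtain ⟨a', ha', b', hb', rfl⟩ := hy
      exact ⟨a + a', add_mem ha ha', b + b', add_mem hb hb', by ring⟩
    | mul x y _ _ hx hy =>
      obtain ⟨a, ha, b, hb, rfl⟩ := hx
      obtain ⟨a', ha', b', hb', rfl⟩ := hy
      refine ⟨a * a' + b * b' * v, add_mem (mul_mem ha ha') (mul_mem (mul_mem hb hb') hv),
        a * b' + b * a' + b * b' * u, add_mem (add_mem (mul_mem ha hb') (mul_mem hb ha'))
          (mul_mem (mul_mem hb hb') hu), ?_⟩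
      linear_combination b * b' * hc
  obtain ⟨a, ha, b, hb, rfl⟩ := key
  rw [map_add, map_mul, hφ a ha, hφ b hb] at hφf
  have : b * (φ c - c) = 0 := by linear_combination hφf
  rcases mul_eq_zero.mp this with h | h
  · rw [h, zero_mul, add_zero]; exact ha
  · exact absurd (sub_eq_zero.mp h) hφc

end Descent

section Observables

variable {k : Type} [Field k] {n : ℕ}

lemma qObs_mem_adjoin_ratioSet (r : ℤ) :
    qObs k n r ∈ IntermediateField.adjoin k (ratioSet k n) := by
  rw [qObs, Finset.sum_mul_sum]
  refine sum_mem fun i _ => sum_mem fun j _ => ?_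
  rw [zpow_neg, ← div_eq_mul_inv, ← div_zpow]
  refine zpow_mem ?_ r
  by_cases h : i = j
  · rw [h, div_self (xv_ne_zero j)]; exact one_mem _
  · exact IntermediateField.subset_adjoin _ _ ⟨i, j, h, rfl⟩

lemma qObs_mem_fixedField (r : ℤ) :
    qObs k n r ∈ IntermediateField.fixedField (Gsub k n) := by
  rw [IntermediateField.mem_fixedField_iff]
  intro φ hφ
  induction hφ using Subgroup.closure_induction with
  | mem φ h =>
    obtain ⟨σ, h | h⟩ := h
    · simp only [qObs, map_mul, map_sum, map_zpow₀, h]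
      rw [Equiv.sum_comp σ fun i => xv k n i ^ r, Equiv.sum_comp σ fun i => xv k n i ^ (-r)]
    · simp only [qObs, map_mul, map_sum, map_zpow₀, h, inv_zpow', neg_neg]
      rw [Equiv.sum_comp σ fun i => xv k n i ^ r, Equiv.sum_comp σ fun i => xv k n i ^ (-r),
        mul_comm]
  | one => rfl
  | mul φ ψ _ _ hφ hψ => rw [AlgEquiv.mul_apply, hψ, hφ]
  | inv φ _ hφ =>
    have h := congrArg φ.symm hφ
    rw [AlgEquiv.symm_apply_apply] at h
    exact h.symm

lemma qObs_mem_InvF (r : ℤ) : qObs k n r ∈ InvF k n :=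
  ⟨qObs_mem_adjoin_ratioSet r, qObs_mem_fixedField r⟩

/-- A nonzero form of degree one is transcendental over the field of ratios. -/
lemma transcendental_sum_xv [CharZero k] (hn : ∑ i, xv k n i ≠ 0) :
    Transcendental (IntermediateField.adjoin k (ratioSet k n)) (∑ i, xv k n i) := by
  set L := IntermediateField.adjoin k (ratioSet k n)
  have hg (m : ℕ) : ∃ φ : RF k n →ₐ[L] RF k n,
      φ (∑ i, xv k n i) = ((m + 1 : ℕ) : RF k n) * ∑ i, xv k n i := by
    have hm : ((m + 1 : ℕ) : k) ≠ 0 := Nat.cast_ne_zero.mpr m.succ_ne_zero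
    obtain ⟨φ, hφ⟩ := exists_scale_algHom (n := n) hm
    have hfix (x : RF k n) (hx : x ∈ L) : φ x = x := by
      induction hx using IntermediateField.adjoin_induction with
      | mem x hx =>
        obtain ⟨i, j, _, rfl⟩ := hx
        rw [map_div₀, hφ, hφ, mul_div_mul_left _ _ (by rwa [ne_eq, map_eq_zero])]
      | algebraMap x => exact φ.commutes x
      | add x y _ _ hx hy => rw [map_add, hx, hy]
      | inv x _ hx => rw [map_inv₀, hx]
      | mul x y _ _ hx hy => rw [map_mul, hx, hy]
    refine ⟨{ φ.toRingHom with commutes' := fun x => hfix x x.2 }, ?_⟩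
    change φ _ = _
    simp only [map_sum, hφ, Finset.mul_sum, map_natCast]
  choose g hg using hg
  refine transcendental_of_injective_algHom g fun a b hab => ?_
  have : CharZero (RF k n) := charZero_of_injective_algebraMap (algebraMap k _).injective
  simp only [hg] at hab
  have := Nat.cast_injective (mul_right_cancel₀ hn hab)
  omega

end Observables

section FourVariables

/-- The expressions of the second, third and fourth observables in four variables determine
`A = e₁e₃/e₄`, `B = e₂²/e₄` and `E = e₁²e₂/e₄ + e₂e₃²/e₄²`. -/
lemma mem_of_observables_mem {k F : Type*} [Field k] [Field F] [CharZero F] [Algebra k F]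
    {K : IntermediateField k F} {A B E q₂ q₃ q₄ : F} (hB : B ≠ 0)
    (hA : A ∈ K) (h₂ : q₂ ∈ K) (h₃ : q₃ ∈ K) (h₄ : q₄ ∈ K)
    (e₂ : q₂ = A ^ 2 - 2 * E + 4 * B)
    (e₃ : q₃ = A ^ 3 - 3 * A * E + 9 * A * B - 9 * E + 9 * A + 3 * (E ^ 2 / B - 2 * A ^ 2))
    (e₄ : q₄ = A ^ 2 * (A ^ 2 - 4 * E + 16 * B)
      + (4 * A + 2 * B - 4) * (E ^ 2 / B - 2 * A ^ 2 - 4 * E) + (4 * A + 2 * B - 4) ^ 2)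
    (hD : 2 * (A - 2) * B ^ 2 + 2 * (E - 2 * B) ^ 2 - (A - 2) * (6 * A - 4) * B ≠ 0) :
    B ∈ K ∧ E ∈ K := by
  have c2 : ((2 : K) : F) = 2 := rfl
  have c3 : ((3 : K) : F) = 3 := rfl
  have c4 : ((4 : K) : F) = 4 := rfl
  have c6 : ((6 : K) : F) = 6 := rfl
  have c9 : ((9 : K) : F) = 9 := rfl
  lift A to K using hA
  lift q₂ to K using h₂
  lift q₃ to K using h₃
  lift q₄ to K using h₄
  obtain ⟨s, hs⟩ : ∃ s : K, s = (A ^ 2 - q₂) / 2 := ⟨_, rfl⟩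
  have hs' : E = 2 * B + s := by
    rw [hs]; push_cast [c2, c3, c4, c6, c9]; rw [e₂]; ring
  subst hs'
  obtain ⟨r, hr⟩ : ∃ r : K, r = (q₃ - (A ^ 3 - 3 * A * s + 3 * s + 9 * A - 6 * A ^ 2)) / 3 :=
    ⟨_, rfl⟩
  have hr' : (r : F) = (A - 2) * B + s ^ 2 / B := by
    rw [hr]; push_cast [c2, c3, c4, c6, c9]; rw [e₃]; field_simp; ring
  have hBD : B * (2 * r - (A - 2) * (6 * A - 4)) ≠ 0 := by
    rw [hr']
    convert hD using 1
    field_simp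
    ring
  have hmem : B = ((A * s ^ 2 + (A - 2) * ((4 * A - 4) * (r - 2 * A ^ 2 + 4 * A - 4)
      - 4 * A ^ 2 * s + A ^ 4 - q₄) / 2) / (2 * r - (A - 2) * (6 * A - 4)) : K) := by
    push_cast [c2, c3, c4, c6, c9]
    rw [eq_div_iff (right_ne_zero_of_mul hBD), hr', e₄]
    field_simp
    ring
  have hBK : B ∈ K := by rw [hmem]; exact SetLike.coe_mem _
  exact ⟨hBK, add_mem (mul_mem (ofNat_mem K 2) hBK) s.2⟩

/-- The first four observables in terms of elementary symmetric functions. -/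
lemma observables_eq {F : Type*} [Field F] {x : Fin 4 → F} (hx : ∀ i, x i ≠ 0)
    {e₁ e₂ e₃ e₄ A B E : F}
    (h₁ : e₁ = x 0 + x 1 + x 2 + x 3)
    (h₂ : e₂ = x 0 * x 1 + x 0 * x 2 + x 0 * x 3 + x 1 * x 2 + x 1 * x 3 + x 2 * x 3)
    (h₃ : e₃ = x 0 * x 1 * x 2 + x 0 * x 1 * x 3 + x 0 * x 2 * x 3 + x 1 * x 2 * x 3)
    (h₄ : e₄ = x 0 * x 1 * x 2 * x 3) (h₂0 : e₂ ≠ 0)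
    (hA : A = e₁ * e₃ / e₄) (hB : B = e₂ ^ 2 / e₄)
    (hE : E = e₁ ^ 2 * e₂ / e₄ + e₂ * e₃ ^ 2 / e₄ ^ 2) :
    (∑ i, x i ^ (1 : ℤ)) * (∑ i, x i ^ (-1 : ℤ)) = A ∧
    (∑ i, x i ^ (2 : ℤ)) * (∑ i, x i ^ (-2 : ℤ)) = A ^ 2 - 2 * E + 4 * B ∧
    (∑ i, x i ^ (3 : ℤ)) * (∑ i, x i ^ (-3 : ℤ)) =
      A ^ 3 - 3 * A * E + 9 * A * B - 9 * E + 9 * A + 3 * (E ^ 2 / B - 2 * A ^ 2) ∧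
    (∑ i, x i ^ (4 : ℤ)) * (∑ i, x i ^ (-4 : ℤ)) = A ^ 2 * (A ^ 2 - 4 * E + 16 * B)
      + (4 * A + 2 * B - 4) * (E ^ 2 / B - 2 * A ^ 2 - 4 * E) + (4 * A + 2 * B - 4) ^ 2 := by
  have newton (x : Fin 4 → F) {e₁ e₂ e₃ e₄ : F}
      (h₁ : e₁ = x 0 + x 1 + x 2 + x 3)
      (h₂ : e₂ = x 0 * x 1 + x 0 * x 2 + x 0 * x 3 + x 1 * x 2 + x 1 * x 3 + x 2 * x 3)
      (h₃ : e₃ = x 0 * x 1 * x 2 + x 0 * x 1 * x 3 + x 0 * x 2 * x 3 + x 1 * x 2 * x 3)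
      (h₄ : e₄ = x 0 * x 1 * x 2 * x 3) :
      ∑ i, x i ^ 1 = e₁ ∧ ∑ i, x i ^ 2 = e₁ ^ 2 - 2 * e₂ ∧
      ∑ i, x i ^ 3 = e₁ ^ 3 - 3 * e₁ * e₂ + 3 * e₃ ∧
      ∑ i, x i ^ 4 = e₁ ^ 4 - 4 * e₁ ^ 2 * e₂ + 4 * e₁ * e₃ + 2 * e₂ ^ 2 - 4 * e₄ := by
    subst h₁ h₂ h₃ h₄
    simp only [Fin.sum_univ_four]
    refine ⟨?_, ?_, ?_, ?_⟩ <;> ring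
  have hx0 := hx 0
  have hx1 := hx 1
  have hx2 := hx 2
  have hx3 := hx 3
  have h₄0 : e₄ ≠ 0 := by
    rw [h₄]; exact mul_ne_zero (mul_ne_zero (mul_ne_zero hx0 hx1) hx2) hx3
  obtain ⟨p₁, p₂, p₃, p₄⟩ := newton x h₁ h₂ h₃ h₄
  obtain ⟨r₁, r₂, r₃, r₄⟩ := newton (fun i => (x i)⁻¹) (e₁ := e₃ / e₄) (e₂ := e₂ / e₄)
    (e₃ := e₁ / e₄) (e₄ := 1 / e₄)
    (by rw [h₃, h₄]; field_simp; ring) (by rw [h₂, h₄]; field_simp; ring)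
    (by rw [h₁, h₄]; field_simp; ring) (by rw [h₄]; field_simp)
  have hz (m : ℕ) : (∑ i, x i ^ (m : ℤ)) * (∑ i, x i ^ (-m : ℤ)) =
      (∑ i, x i ^ m) * (∑ i, (x i)⁻¹ ^ m) := by
    simp only [zpow_neg, zpow_natCast, inv_pow]
  subst hA hB hE
  refine ⟨(hz 1).trans ?_, (hz 2).trans ?_, (hz 3).trans ?_, (hz 4).trans ?_⟩
  · rw [p₁, r₁]; ring
  · rw [p₂, r₂]; field_simp; ring
  · rw [p₃, r₃]; field_simp; ring
  · rw [p₄, r₄]; field_simp; ring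

end FourVariables

section EsymmFour

open MvPolynomial

variable (k : Type) [Field k]

lemma esymm_one_four : esymm (Fin 4) k 1 = X 0 + X 1 + X 2 + X 3 := by
  rw [esymm_one, Fin.sum_univ_four]

lemma esymm_two_four : esymm (Fin 4) k 2 =
    X 0 * X 1 + X 0 * X 2 + X 0 * X 3 + X 1 * X 2 + X 1 * X 3 + X 2 * X 3 := by
  have h : (Finset.univ : Finset (Fin 4)).powersetCard 2 =
      {{0, 1}, {0, 2}, {0, 3}, {1, 2}, {1, 3}, {2, 3}} := by decide
  rw [esymm, h]
  repeat rw [Finset.sum_insert (by decide)]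
  simp [Finset.prod_insert, add_assoc]

lemma esymm_three_four : esymm (Fin 4) k 3 =
    X 0 * X 1 * X 2 + X 0 * X 1 * X 3 + X 0 * X 2 * X 3 + X 1 * X 2 * X 3 := by
  have h : (Finset.univ : Finset (Fin 4)).powersetCard 3 =
      {{0, 1, 2}, {0, 1, 3}, {0, 2, 3}, {1, 2, 3}} := by decide
  rw [esymm, h]
  repeat rw [Finset.sum_insert (by decide)]
  simp [Finset.prod_insert, add_assoc, mul_assoc]

lemma esymm_four_four : esymm (Fin 4) k 4 = X 0 * X 1 * X 2 * X 3 := by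
  have h : (Finset.univ : Finset (Fin 4)).powersetCard 4 = {Finset.univ} := by decide
  rw [esymm, h, Finset.sum_singleton, Fin.prod_univ_four]

variable {k}

lemma algebraMap_ne_zero_of_eval {n : ℕ} {P : MvPolynomial (Fin n) k} (v : Fin n → k)
    (h : eval v P ≠ 0) : algebraMap _ (RF k n) P ≠ 0 := by
  have : P ≠ 0 := by rintro rfl; exact h (map_zero _)
  simpa using this

lemma esymm_four_eliminant_ne_zero [CharZero k] {e₁ e₂ e₃ e₄ : RF k 4}
    (h₁ : e₁ = algebraMap _ _ (esymm (Fin 4) k 1)) (h₂ : e₂ = algebraMap _ _ (esymm (Fin 4) k 2))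
    (h₃ : e₃ = algebraMap _ _ (esymm (Fin 4) k 3)) (h₄ : e₄ = algebraMap _ _ (esymm (Fin 4) k 4)) :
    2 * (e₁ * e₃ - 2 * e₄) * e₂ ^ 4 * e₄
      + 2 * (e₁ ^ 2 * e₂ * e₄ + e₂ * e₃ ^ 2 - 2 * e₂ ^ 2 * e₄) ^ 2
      - (e₁ * e₃ - 2 * e₄) * (6 * e₁ * e₃ - 4 * e₄) * e₂ ^ 2 * e₄ ≠ 0 := by
  obtain ⟨s, hs⟩ : ∃ s : ℕ → MvPolynomial (Fin 4) k, s = esymm (Fin 4) k := ⟨_, rfl⟩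
  have h := algebraMap_ne_zero_of_eval (P := 2 * (s 1 * s 3 - 2 * s 4) * s 2 ^ 4 * s 4
    + 2 * (s 1 ^ 2 * s 2 * s 4 + s 2 * s 3 ^ 2 - 2 * s 2 ^ 2 * s 4) ^ 2
    - (s 1 * s 3 - 2 * s 4) * (6 * s 1 * s 3 - 4 * s 4) * s 2 ^ 2 * s 4) ![1, -1, 2, -2] (by
      rw [hs, esymm_one_four, esymm_two_four, esymm_three_four, esymm_four_four]
      simp
      norm_num)
  simpa only [map_add, map_sub, map_mul, map_pow, map_ofNat, hs, ← h₁, ← h₂, ← h₃, ← h₄] using h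

lemma esymm_div_pow_mem_adjoin_ratioSet {e₁ e₂ e₃ e₄ : RF k 4}
    (h₁ : e₁ = xv k 4 0 + xv k 4 1 + xv k 4 2 + xv k 4 3)
    (h₂ : e₂ = xv k 4 0 * xv k 4 1 + xv k 4 0 * xv k 4 2 + xv k 4 0 * xv k 4 3
      + xv k 4 1 * xv k 4 2 + xv k 4 1 * xv k 4 3 + xv k 4 2 * xv k 4 3)
    (h₃ : e₃ = xv k 4 0 * xv k 4 1 * xv k 4 2 + xv k 4 0 * xv k 4 1 * xv k 4 3
      + xv k 4 0 * xv k 4 2 * xv k 4 3 + xv k 4 1 * xv k 4 2 * xv k 4 3)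
    (h₄ : e₄ = xv k 4 0 * xv k 4 1 * xv k 4 2 * xv k 4 3) :
    e₁ / xv k 4 0 ∈ IntermediateField.adjoin k (ratioSet k 4) ∧
    e₂ / xv k 4 0 ^ 2 ∈ IntermediateField.adjoin k (ratioSet k 4) ∧
    e₃ / xv k 4 0 ^ 3 ∈ IntermediateField.adjoin k (ratioSet k 4) ∧
    e₄ / xv k 4 0 ^ 4 ∈ IntermediateField.adjoin k (ratioSet k 4) := by
  set L := IntermediateField.adjoin k (ratioSet k 4)
  have hx0 : xv k 4 0 ≠ 0 := xv_ne_zero 0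
  have hy (i : Fin 4) (hi : i ≠ 0) : xv k 4 i / xv k 4 0 ∈ L :=
    IntermediateField.subset_adjoin _ _ ⟨i, 0, hi, rfl⟩
  obtain ⟨y₁, hy₁⟩ : ∃ y : L, (y : RF k 4) = xv k 4 1 / xv k 4 0 := ⟨⟨_, hy 1 (by decide)⟩, rfl⟩
  obtain ⟨y₂, hy₂⟩ : ∃ y : L, (y : RF k 4) = xv k 4 2 / xv k 4 0 := ⟨⟨_, hy 2 (by decide)⟩, rfl⟩
  obtain ⟨y₃, hy₃⟩ : ∃ y : L, (y : RF k 4) = xv k 4 3 / xv k 4 0 := ⟨⟨_, hy 3 (by decide)⟩, rfl⟩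
  have r₁ : e₁ / xv k 4 0 ∈ L := by
    have : e₁ / xv k 4 0 = ((1 + y₁ + y₂ + y₃ : L) : RF k 4) := by
      push_cast; rw [h₁, hy₁, hy₂, hy₃]; field_simp
    rw [this]; exact SetLike.coe_mem _
  have r₂ : e₂ / xv k 4 0 ^ 2 ∈ L := by
    have : e₂ / xv k 4 0 ^ 2 =
        ((y₁ + y₂ + y₃ + y₁ * y₂ + y₁ * y₃ + y₂ * y₃ : L) : RF k 4) := by
      push_cast; rw [h₂, hy₁, hy₂, hy₃]; field_simp
    rw [this]; exact SetLike.coe_mem _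
  have r₃ : e₃ / xv k 4 0 ^ 3 ∈ L := by
    have : e₃ / xv k 4 0 ^ 3 =
        ((y₁ * y₂ + y₁ * y₃ + y₂ * y₃ + y₁ * y₂ * y₃ : L) : RF k 4) := by
      push_cast; rw [h₃, hy₁, hy₂, hy₃]; field_simp
    rw [this]; exact SetLike.coe_mem _
  have r₄ : e₄ / xv k 4 0 ^ 4 ∈ L := by
    have : e₄ / xv k 4 0 ^ 4 = ((y₁ * y₂ * y₃ : L) : RF k 4) := by
      push_cast; rw [h₄, hy₁, hy₂, hy₃]; field_simp
    rw [this]; exact SetLike.coe_mem _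
  exact ⟨r₁, r₂, r₃, r₄⟩

end EsymmFour

/-- For `n = 4` the invariant field is generated by the first four observables:
`k(X)₀^G = k(q₁, q₂, q₃, q₄)`. -/
theorem stmt6 (k : Type) [Field k] [CharZero k] :
    InvF k 4 =
      IntermediateField.adjoin k
        {qObs k 4 1, qObs k 4 2, qObs k 4 3, qObs k 4 4} := by
  set K := IntermediateField.adjoin k {qObs k 4 1, qObs k 4 2, qObs k 4 3, qObs k 4 4} with hK
  have hKle : K ≤ InvF k 4 := by
    rw [hK, IntermediateField.adjoin_le_iff]
    rintro _ (rfl | rfl | rfl | rfl) <;> exact qObs_mem_InvF _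
  refine le_antisymm ?_ hKle
  have hchar : CharZero (RF k 4) := charZero_of_injective_algebraMap (algebraMap k _).injective
  obtain ⟨e₁, he₁⟩ : ∃ e, e = algebraMap _ (RF k 4) (MvPolynomial.esymm (Fin 4) k 1) := ⟨_, rfl⟩
  obtain ⟨e₂, he₂⟩ : ∃ e, e = algebraMap _ (RF k 4) (MvPolynomial.esymm (Fin 4) k 2) := ⟨_, rfl⟩
  obtain ⟨e₃, he₃⟩ : ∃ e, e = algebraMap _ (RF k 4) (MvPolynomial.esymm (Fin 4) k 3) := ⟨_, rfl⟩
  obtain ⟨e₄, he₄⟩ : ∃ e, e = algebraMap _ (RF k 4) (MvPolynomial.esymm (Fin 4) k 4) := ⟨_, rfl⟩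
  have e₁0 : e₁ ≠ 0 := he₁ ▸ algebraMap_ne_zero_of_eval (fun _ => 1) (by
    rw [esymm_one_four]; simp only [map_add, MvPolynomial.eval_X]; norm_num)
  have e₂0 : e₂ ≠ 0 := he₂ ▸ algebraMap_ne_zero_of_eval (fun _ => 1) (by
    simp [esymm_two_four]; norm_num)
  have e₃0 : e₃ ≠ 0 := he₃ ▸ algebraMap_ne_zero_of_eval (fun _ => 1) (by
    simp [esymm_three_four]; norm_num)
  have e₄0 : e₄ ≠ 0 := he₄ ▸ algebraMap_ne_zero_of_eval (fun _ => 1) (by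
    simp [esymm_four_four])
  have hτ : e₁ ^ 2 * e₄ - e₃ ^ 2 ≠ 0 := by
    rw [he₁, he₃, he₄, ← map_pow, ← map_pow, ← map_mul, ← map_sub]
    refine algebraMap_ne_zero_of_eval ![1, 1, 1, 0] ?_
    simp [esymm_three_four, esymm_four_four]
  have hD := esymm_four_eliminant_ne_zero he₁ he₂ he₃ he₄
  have hx : ∀ i, xv k 4 i ≠ 0 := xv_ne_zero
  have hx0 := hx 0
  have hx1 := hx 1
  have hx2 := hx 2
  have hx3 := hx 3
  have h₁ : e₁ = xv k 4 0 + xv k 4 1 + xv k 4 2 + xv k 4 3 := by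
    simp only [he₁, esymm_one_four, map_add, xv]
  have h₂ : e₂ = xv k 4 0 * xv k 4 1 + xv k 4 0 * xv k 4 2 + xv k 4 0 * xv k 4 3
      + xv k 4 1 * xv k 4 2 + xv k 4 1 * xv k 4 3 + xv k 4 2 * xv k 4 3 := by
    simp only [he₂, esymm_two_four, map_add, map_mul, xv]
  have h₃ : e₃ = xv k 4 0 * xv k 4 1 * xv k 4 2 + xv k 4 0 * xv k 4 1 * xv k 4 3
      + xv k 4 0 * xv k 4 2 * xv k 4 3 + xv k 4 1 * xv k 4 2 * xv k 4 3 := by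
    simp only [he₃, esymm_three_four, map_add, map_mul, xv]
  have h₄ : e₄ = xv k 4 0 * xv k 4 1 * xv k 4 2 * xv k 4 3 := by
    simp only [he₄, esymm_four_four, map_mul, xv]
  obtain ⟨A, hA⟩ : ∃ A, A = e₁ * e₃ / e₄ := ⟨_, rfl⟩
  obtain ⟨B, hB⟩ : ∃ B, B = e₂ ^ 2 / e₄ := ⟨_, rfl⟩
  obtain ⟨C, hC⟩ : ∃ C, C = e₁ ^ 2 / e₂ := ⟨_, rfl⟩
  obtain ⟨E, hE⟩ : ∃ E, E = e₁ ^ 2 * e₂ / e₄ + e₂ * e₃ ^ 2 / e₄ ^ 2 := ⟨_, rfl⟩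
  have hB0 : B ≠ 0 := by rw [hB]; exact div_ne_zero (pow_ne_zero 2 e₂0) e₄0
  obtain ⟨q₁, q₂, q₃, q₄⟩ := observables_eq hx h₁ h₂ h₃ h₄ e₂0 hA hB hE
  have hAK : A ∈ K := q₁ ▸ IntermediateField.subset_adjoin k _ (by simp [qObs])
  have hBE : B ∈ K ∧ E ∈ K := by
    refine mem_of_observables_mem hB0 hAK (IntermediateField.subset_adjoin k _ ?_)
      (IntermediateField.subset_adjoin k _ ?_) (IntermediateField.subset_adjoin k _ ?_)
      q₂ q₃ q₄ ?_
    · exact Or.inr (Or.inl rfl)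
    · exact Or.inr (Or.inr (Or.inl rfl))
    · exact Or.inr (Or.inr (Or.inr rfl))
    · refine fun h => hD ?_
      rw [hA, hB, hE] at h
      field_simp at h
      linear_combination (exp := 1) h
  rintro f ⟨hfL, hfG⟩
  rw [SetLike.mem_coe, IntermediateField.mem_fixedField_iff] at hfG
  set L := IntermediateField.adjoin k (ratioSet k 4) with hL
  set M : IntermediateField k (RF k 4) := IntermediateField.adjoin k {A, B, C} with hM
  have hML : M ≤ L := by
    obtain ⟨r₁, r₂, r₃, r₄⟩ := esymm_div_pow_mem_adjoin_ratioSet h₁ h₂ h₃ h₄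
    rw [hM, IntermediateField.adjoin_le_iff]
    rintro x hx
    simp only [Set.mem_insert_iff, Set.mem_singleton_iff] at hx
    rcases hx with h | h | h <;> rw [SetLike.mem_coe, h]
    · have : A = (e₁ / xv k 4 0) * (e₃ / xv k 4 0 ^ 3) / (e₄ / xv k 4 0 ^ 4) := by
        rw [hA]; field_simp
      rw [this]; exact div_mem (mul_mem r₁ r₃) r₄
    · have : B = (e₂ / xv k 4 0 ^ 2) ^ 2 / (e₄ / xv k 4 0 ^ 4) := by
        rw [hB]; field_simp
      rw [this]; exact div_mem (pow_mem r₂ 2) r₄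
    · have : C = (e₁ / xv k 4 0) ^ 2 / (e₂ / xv k 4 0 ^ 2) := by
        rw [hC]; field_simp
      rw [this]; exact div_mem (pow_mem r₁ 2) r₂
  have hfM : f ∈ M := by
    have hsum : ∑ i, xv k 4 i = e₁ := by rw [Fin.sum_univ_four, h₁]
    have ht := transcendental_sum_xv (hsum ▸ e₁0)
    rw [hsum] at ht
    refine IntermediateField.mem_of_mem_adjoin_of_transcendental hML ht hfL ?_
    obtain ⟨P, Q, hP, hQ, rfl⟩ := exists_isSymmetric_div (f := f) fun σ φ hφ =>
      hfG φ (Subgroup.subset_closure ⟨σ, Or.inl hφ⟩)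
    set N := IntermediateField.adjoin M {e₁} with hN
    have hMN (x : RF k 4) (hx : x ∈ M) : x ∈ N := N.algebraMap_mem ⟨x, hx⟩
    have m₁ : e₁ ∈ N := IntermediateField.mem_adjoin_simple_self M e₁
    have mA := hMN A (IntermediateField.subset_adjoin _ _ (by simp))
    have mB := hMN B (IntermediateField.subset_adjoin _ _ (by simp))
    have mC := hMN C (IntermediateField.subset_adjoin _ _ (by simp))
    have m₂ : e₂ ∈ N := by
      have : e₂ = e₁ ^ 2 / C := by rw [hC]; field_simp
      rw [this]; exact div_mem (pow_mem m₁ 2) mC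
    have m₄ : e₄ ∈ N := by
      have : e₄ = e₂ ^ 2 / B := by rw [hB]; field_simp
      rw [this]; exact div_mem (pow_mem m₂ 2) mB
    have m₃ : e₃ ∈ N := by
      have : e₃ = A * e₄ / e₁ := by rw [hA]; field_simp
      rw [this]; exact div_mem (mul_mem mA m₄) m₁
    have he (i : Fin 4) : algebraMap _ (RF k 4) (MvPolynomial.esymm (Fin 4) k (i + 1)) ∈
        N.restrictScalars k := by
      fin_cases i
      · exact he₁ ▸ m₁
      · exact he₂ ▸ m₂
      · exact he₃ ▸ m₃
      · exact he₄ ▸ m₄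
    exact div_mem (algebraMap_mem_of_isSymmetric hP he) (algebraMap_mem_of_isSymmetric hQ he)
  have hMK : M ≤ (IntermediateField.adjoin K {C}).restrictScalars k := by
    rw [hM, IntermediateField.adjoin_le_iff]
    rintro x hx
    simp only [Set.mem_insert_iff, Set.mem_singleton_iff] at hx
    rcases hx with h | h | h <;> rw [SetLike.mem_coe, h]
    · exact IntermediateField.algebraMap_mem _ (⟨A, hAK⟩ : K)
    · exact IntermediateField.algebraMap_mem _ (⟨B, hBE.1⟩ : K)
    · exact IntermediateField.mem_adjoin_simple_self K C
  obtain ⟨τ, hτx⟩ := exists_inv_algEquiv (k := k) (n := 4)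
  have hτG : τ ∈ Gsub k 4 := Subgroup.subset_closure ⟨1, Or.inr hτx⟩
  refine IntermediateField.mem_of_mem_adjoin_quadratic (c := C) (u := E / B) (v := -(A ^ 2 / B))
    (φ := (τ : RF k 4 →ₐ[k] RF k 4)) (div_mem hBE.2 hBE.1)
    (neg_mem (div_mem (pow_mem hAK 2) hBE.1)) ?_ (hMK hfM) (fun x hx => ?_) ?_ (hfG τ hτG)
  · rw [hA, hB, hC, hE]; field_simp; ring
  · exact (IntermediateField.mem_fixedField_iff _ _).mp (hKle hx).2 τ hτG
  · have t₁ : τ e₁ = e₃ / e₄ := by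
      rw [h₁]; simp only [map_add, hτx]; rw [h₃, h₄]; field_simp; ring
    have t₂ : τ e₂ = e₂ / e₄ := by
      rw [h₂]; simp only [map_add, map_mul, hτx]; rw [h₄]; field_simp; ring
    change τ C ≠ C
    rw [hC, map_div₀, map_pow, t₁, t₂]
    refine fun h => hτ ?_
    field_simp at h
    linear_combination -h
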